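/- If ψ is a finite composition of maps of the form θ_n or η_n with n ∈ ℚ ∖ ℤ, then for every nonzero U ∈ H(q) the element ψ(U) is a nonzero element of H(q). -/

import Mathlib

noncomputable section

/-- Generators of the `q`-deformed Heisenberg algebra. -/
inductive HGen : Type
  | A : HGen
  | B : HGen

/-- The defining relation `AB = q • BA + 1` of the `q`-deformed Heisenberg algebra. -/
inductive HRel (q : ℂ) : FreeAlgebra ℂ HGen → FreeAlgebra ℂ HGen → Prop
  | rel : HRel q (FreeAlgebra.ι ℂ HGen.A * FreeAlgebra.ι ℂ HGen.B)
      (q • (FreeAlgebra.ι ℂ HGen.B * FreeAlgebra.ι ℂ HGen.A) + 1)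

/-- The `q`-deformed Heisenberg algebra `H(q)`, presented by generators `A`, `B`
and the single relation `AB - q • BA = 1`. -/
abbrev HAlg (q : ℂ) := RingQuot (HRel q)

/-- The generator `A` of `H(q)`. -/
def genA (q : ℂ) : HAlg q := RingQuot.mkAlgHom ℂ (HRel q) (FreeAlgebra.ι ℂ HGen.A)

/-- The generator `B` of `H(q)`. -/
def genB (q : ℂ) : HAlg q := RingQuot.mkAlgHom ℂ (HRel q) (FreeAlgebra.ι ℂ HGen.B)

/-- The element `C = AB - BA` of `H(q)`. -/
def genC (q : ℂ) : HAlg q := genA q * genB q - genB q * genA q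

/-- `q = e^{-2ω}`. -/
def qOf (ω : ℝ) : ℂ := Complex.exp (-2 * (ω : ℂ))

/-- `q^r = e^{-2ωr}` for a rational exponent `r`. -/
def qexp (ω : ℝ) (r : ℚ) : ℂ := Complex.exp (-2 * (ω : ℂ) * (r : ℂ))

/-- The deformed commutator map `θ_n : γ ↦ Aγ - q^n γA` on `H(q)`, `n ∈ ℚ`. -/
def thetaQ (ω : ℝ) (n : ℚ) (x : HAlg (qOf ω)) : HAlg (qOf ω) :=
  genA (qOf ω) * x - qexp ω n • (x * genA (qOf ω))

/-- The deformed commutator map `η_n : γ ↦ Bγ - q^n γB` on `H(q)`, `n ∈ ℚ`. -/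
def etaQ (ω : ℝ) (n : ℚ) (x : HAlg (qOf ω)) : HAlg (qOf ω) :=
  genB (qOf ω) * x - qexp ω n • (x * genB (qOf ω))

/-- The set `Φ ∖ Φ_ℤ` of deformed commutator maps `θ_n`, `η_n` with `n ∈ ℚ ∖ ℤ`. -/
def PhiNonInt (ω : ℝ) : Set (HAlg (qOf ω) → HAlg (qOf ω)) :=
  {f | ∃ n : ℚ, (∀ m : ℤ, (m : ℚ) ≠ n) ∧ (f = thetaQ ω n ∨ f = etaQ ω n)}

/-- The `q`-integer `[k] = 1 + q + ⋯ + q^(k-1)`. -/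
def qInt (q : ℂ) (k : ℕ) : ℂ := ∑ i ∈ Finset.range k, q ^ i

lemma qInt_zero (q : ℂ) : qInt q 0 = 0 := by simp [qInt]

lemma qInt_succ (q : ℂ) (k : ℕ) : qInt q (k + 1) = qInt q k + q ^ k :=
  Finset.sum_range_succ _ _

lemma genA_mul_genB (q : ℂ) : genA q * genB q = q • (genB q * genA q) + 1 := by
  have h := RingQuot.mkAlgHom_rel ℂ (HRel.rel (q := q))
  simp only [map_mul, map_add, map_smul, map_one] at h
  exact h

lemma genA_mul_genB_pow_succ (q : ℂ) (k : ℕ) :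
    genA q * genB q ^ (k + 1) =
      q ^ (k + 1) • (genB q ^ (k + 1) * genA q) + qInt q (k + 1) • genB q ^ k := by
  induction k with
  | zero => simp [qInt, genA_mul_genB]
  | succ k ih =>
    rw [pow_succ (genB q) (k + 1), ← mul_assoc, ih, add_mul, smul_mul_assoc, mul_assoc,
      genA_mul_genB, qInt_succ q (k + 1), mul_add, mul_one, mul_smul_comm, smul_mul_assoc, ← mul_assoc,
      ← pow_succ, ← pow_succ]
    module

lemma genA_pow_succ_mul_genB (q : ℂ) (l : ℕ) :
    genA q ^ (l + 1) * genB q =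
      q ^ (l + 1) • (genB q * genA q ^ (l + 1)) + qInt q (l + 1) • genA q ^ l := by
  induction l with
  | zero => simp [qInt, genA_mul_genB]
  | succ l ih =>
    rw [pow_succ' (genA q) (l + 1), mul_assoc, ih, mul_add, mul_smul_comm, ← mul_assoc,
      genA_mul_genB, qInt_succ q (l + 1), add_mul, one_mul, smul_mul_assoc, mul_smul_comm, mul_assoc,
      ← pow_succ', ← pow_succ']
    module

/-- Left multiplication by `A` in terms of the basis `B^k A^l`. -/
def leftA (q : ℂ) : Module.End ℂ (ℕ × ℕ →₀ ℂ) :=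
  Finsupp.linearCombination ℂ fun p : ℕ × ℕ =>
    Finsupp.single (p.1, p.2 + 1) (q ^ p.1) + Finsupp.single (p.1 - 1, p.2) (qInt q p.1)

/-- Left multiplication by `B` in terms of the basis `B^k A^l`. -/
def leftB : Module.End ℂ (ℕ × ℕ →₀ ℂ) :=
  Finsupp.linearCombination ℂ fun p : ℕ × ℕ => Finsupp.single (p.1 + 1, p.2) 1

lemma leftA_single (q : ℂ) (k l : ℕ) : leftA q (Finsupp.single (k, l) 1) =
    Finsupp.single (k, l + 1) (q ^ k) + Finsupp.single (k - 1, l) (qInt q k) := by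
  simp [leftA]

lemma leftB_single (k l : ℕ) (c : ℂ) :
    leftB (Finsupp.single (k, l) c) = Finsupp.single (k + 1, l) c := by
  simp [leftB]

lemma leftA_mul_leftB (q : ℂ) : leftA q * leftB = q • (leftB * leftA q) + 1 := by
  refine Finsupp.lhom_ext' fun ⟨k, l⟩ => LinearMap.ext_ring ?_
  simp only [LinearMap.comp_apply, Finsupp.lsingle_apply, Module.End.mul_apply,
    LinearMap.add_apply, LinearMap.smul_apply, Module.End.one_apply, leftB_single, leftA_single,
    map_add]
  cases k with
  | zero => simp [qInt]
  | succ k =>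
    have h : qInt q (k + 1 + 1) = q * qInt q (k + 1) + 1 := by
      simp [qInt, Finset.sum_range_succ' _ (k + 1), Finset.mul_sum, pow_succ']
    simp [h, pow_succ', add_assoc, -Finsupp.single_mul]

/-- The action of `H(q)` on the span of the formal monomials `B^k A^l`. -/
def leftAction (q : ℂ) : HAlg q →ₐ[ℂ] Module.End ℂ (ℕ × ℕ →₀ ℂ) :=
  RingQuot.liftAlgHom ℂ ⟨FreeAlgebra.lift ℂ fun g => HGen.casesOn g (leftA q) leftB, by
    rintro _ _ ⟨⟩
    simpa using leftA_mul_leftB q⟩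

lemma leftAction_genA (q : ℂ) : leftAction q (genA q) = leftA q := by
  simp [leftAction, genA]

lemma leftAction_genB (q : ℂ) : leftAction q (genB q) = leftB := by
  simp [leftAction, genB]

/-- The coordinates of an element of `H(q)` with respect to the basis `B^k A^l`. -/
def coords (q : ℂ) : HAlg q →ₗ[ℂ] (ℕ × ℕ →₀ ℂ) :=
  (LinearMap.applyₗ (Finsupp.single (0, 0) 1)).comp (leftAction q).toLinearMap

/-- The element of `H(q)` with the given coefficients with respect to `B^k A^l`. -/
def ofCoords (q : ℂ) : (ℕ × ℕ →₀ ℂ) →ₗ[ℂ] HAlg q :=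
  Finsupp.linearCombination ℂ fun p : ℕ × ℕ => genB q ^ p.1 * genA q ^ p.2

lemma ofCoords_single (q : ℂ) (k l : ℕ) (c : ℂ) :
    ofCoords q (Finsupp.single (k, l) c) = c • (genB q ^ k * genA q ^ l) := by
  simp [ofCoords]

lemma coords_monomial (q : ℂ) (k l : ℕ) :
    coords q (genB q ^ k * genA q ^ l) = Finsupp.single (k, l) 1 := by
  have hA : (leftA q ^ l) (Finsupp.single (0, 0) 1) = Finsupp.single (0, l) 1 := by
    induction l with
    | zero => simp
    | succ l ih => simp [pow_succ', ih, leftA_single, qInt_zero]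
  have hB : (leftB ^ k) (Finsupp.single (0, l) 1) = Finsupp.single (k, l) 1 := by
    induction k with
    | zero => simp
    | succ k ih => simp [pow_succ', ih, leftB_single]
  simp [coords, leftAction_genA, leftAction_genB, hA, hB]

lemma ofCoords_leftA (q : ℂ) (v : ℕ × ℕ →₀ ℂ) :
    ofCoords q (leftA q v) = genA q * ofCoords q v := by
  suffices h : ofCoords q ∘ₗ leftA q = LinearMap.mulLeft ℂ (genA q) ∘ₗ ofCoords q from
    LinearMap.congr_fun h v
  refine Finsupp.lhom_ext' fun ⟨k, l⟩ => LinearMap.ext_ring ?_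
  simp only [LinearMap.comp_apply, Finsupp.lsingle_apply, leftA_single, map_add, ofCoords_single,
    LinearMap.mulLeft_apply, one_smul, ← mul_assoc]
  cases k with
  | zero => simp [qInt_zero, pow_succ']
  | succ k =>
    simp [genA_mul_genB_pow_succ, add_mul, mul_assoc, pow_succ' (genA q)]

lemma ofCoords_leftB (q : ℂ) (v : ℕ × ℕ →₀ ℂ) :
    ofCoords q (leftB v) = genB q * ofCoords q v := by
  suffices h : ofCoords q ∘ₗ leftB = LinearMap.mulLeft ℂ (genB q) ∘ₗ ofCoords q from
    LinearMap.congr_fun h v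
  refine Finsupp.lhom_ext' fun ⟨k, l⟩ => LinearMap.ext_ring ?_
  simp [leftB_single, ofCoords_single, pow_succ', mul_assoc]

lemma ofCoords_leftAction (q : ℂ) (x : HAlg q) (v : ℕ × ℕ →₀ ℂ) :
    ofCoords q (leftAction q x v) = x * ofCoords q v := by
  obtain ⟨y, rfl⟩ := RingQuot.mkAlgHom_surjective ℂ (HRel q) x
  induction y using FreeAlgebra.induction generalizing v with
  | grade0 r => simp [Algebra.smul_def]
  | grade1 g =>
    cases g with
    | A => exact (leftAction_genA q) ▸ ofCoords_leftA q v
    | B => exact (leftAction_genB q) ▸ ofCoords_leftB q v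
  | mul a b ha hb => simp [ha, hb, mul_assoc]
  | add a b ha hb => simp [ha, hb, add_mul]

lemma ofCoords_coords (q : ℂ) (x : HAlg q) : ofCoords q (coords q x) = x := by
  have h := ofCoords_leftAction q x (Finsupp.single (0, 0) 1)
  exact h.trans (by simp [ofCoords_single])

lemma coords_ne_zero {q : ℂ} {x : HAlg q} (hx : x ≠ 0) : coords q x ≠ 0 := fun h =>
  hx (by rw [← ofCoords_coords q x, h, map_zero])

lemma coords_comm_genA (q c : ℂ) (v : ℕ × ℕ →₀ ℂ) (k l : ℕ) :
    coords q (genA q * ofCoords q v - c • (ofCoords q v * genA q)) (k, l + 1) =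
      (q ^ k - c) * v (k, l) + qInt q (k + 1) * v (k + 1, l + 1) := by
  induction v using Finsupp.induction_linear with
  | zero => simp
  | add f g hf hg =>
    simp only [map_add, mul_add, add_mul, smul_add, add_sub_add_comm, Finsupp.add_apply, hf, hg]
    ring
  | single p r =>
    obtain ⟨a, b⟩ := p
    rw [ofCoords_single, mul_smul_comm, smul_mul_assoc, mul_assoc _ _ (genA q), ← pow_succ,
      ← mul_assoc]
    cases a with
    | zero =>
      rw [pow_zero, mul_one, one_mul, ← pow_succ', ← one_mul (genA q ^ (b + 1)),
        ← pow_zero (genB q)]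
      simp only [map_sub, map_smul, coords_monomial, Finsupp.sub_apply, Finsupp.smul_apply,
        Finsupp.single_apply, Prod.mk.injEq, smul_eq_mul]
      cases k <;> split_ifs <;> grind
    | succ a =>
      rw [genA_mul_genB_pow_succ, add_mul, smul_mul_assoc, smul_mul_assoc, mul_assoc,
        ← pow_succ']
      simp only [map_sub, map_add, map_smul, coords_monomial, Finsupp.sub_apply, Finsupp.add_apply,
        Finsupp.smul_apply, Finsupp.single_apply, Prod.mk.injEq, smul_eq_mul]
      split_ifs <;> grind

lemma coords_comm_genB (q c : ℂ) (v : ℕ × ℕ →₀ ℂ) (k l : ℕ) :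
    coords q (genB q * ofCoords q v - c • (ofCoords q v * genB q)) (k + 1, l) =
      (1 - c * q ^ l) * v (k, l) - c * qInt q (l + 1) * v (k + 1, l + 1) := by
  induction v using Finsupp.induction_linear with
  | zero => simp
  | add f g hf hg =>
    simp only [map_add, mul_add, add_mul, smul_add, add_sub_add_comm, Finsupp.add_apply, hf, hg]
  | single p r =>
    obtain ⟨a, b⟩ := p
    rw [ofCoords_single, mul_smul_comm, smul_mul_assoc, mul_assoc _ _ (genB q), ← mul_assoc,
      ← pow_succ']
    cases b with
    | zero =>
      rw [pow_zero, mul_one, one_mul, ← pow_succ, ← mul_one (genB q ^ (a + 1)),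
        ← pow_zero (genA q)]
      simp only [map_sub, map_smul, coords_monomial, Finsupp.sub_apply, Finsupp.smul_apply,
        Finsupp.single_apply, Prod.mk.injEq, smul_eq_mul]
      cases l <;> split_ifs <;> grind
    | succ b =>
      rw [genA_pow_succ_mul_genB, mul_add, mul_smul_comm, mul_smul_comm, ← mul_assoc,
        ← pow_succ]
      simp only [map_sub, map_add, map_smul, coords_monomial, Finsupp.sub_apply, Finsupp.add_apply,
        Finsupp.smul_apply, Finsupp.single_apply, Prod.mk.injEq, smul_eq_mul]
      split_ifs <;> grind

lemma comm_genA_ne_zero {q c : ℂ} (hc : ∀ k : ℕ, q ^ k ≠ c) {x : HAlg q} (hx : x ≠ 0) :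
    genA q * x - c • (x * genA q) ≠ 0 := by
  intro h
  obtain ⟨⟨k, l⟩, hp, hmax⟩ := Finset.exists_max_image (coords q x).support Prod.fst
    (Finsupp.support_nonempty_iff.2 (coords_ne_zero hx))
  have hz : coords q x (k + 1, l + 1) = 0 := by
    by_contra hne
    have := hmax _ (Finsupp.mem_support_iff.2 hne)
    simp at this
  have e := coords_comm_genA q c (coords q x) k l
  rw [ofCoords_coords, h, hz] at e
  simp only [map_zero, Finsupp.zero_apply, mul_zero, add_zero] at e
  exact mul_ne_zero (sub_ne_zero.2 (hc k)) (Finsupp.mem_support_iff.1 hp) e.symm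

lemma comm_genB_ne_zero {q c : ℂ} (hc : ∀ l : ℕ, c * q ^ l ≠ 1) {x : HAlg q} (hx : x ≠ 0) :
    genB q * x - c • (x * genB q) ≠ 0 := by
  intro h
  obtain ⟨⟨k, l⟩, hp, hmax⟩ := Finset.exists_max_image (coords q x).support Prod.snd
    (Finsupp.support_nonempty_iff.2 (coords_ne_zero hx))
  have hz : coords q x (k + 1, l + 1) = 0 := by
    by_contra hne
    have := hmax _ (Finsupp.mem_support_iff.2 hne)
    simp at this
  have e := coords_comm_genB q c (coords q x) k l
  rw [ofCoords_coords, h, hz] at e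
  simp only [map_zero, Finsupp.zero_apply, mul_zero, sub_zero] at e
  exact mul_ne_zero (sub_ne_zero.2 (hc l).symm) (Finsupp.mem_support_iff.1 hp) e.symm

lemma qOf_pow (ω : ℝ) (k : ℕ) : qOf ω ^ k = qexp ω k := by
  rw [qOf, qexp, ← Complex.exp_nat_mul]
  push_cast
  ring_nf

lemma qexp_mul (ω : ℝ) (r s : ℚ) : qexp ω r * qexp ω s = qexp ω (r + s) := by
  rw [qexp, qexp, qexp, ← Complex.exp_add]
  push_cast
  ring_nf

lemma qexp_injective {ω : ℝ} (hω : 0 < ω) : Function.Injective (qexp ω) := by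
  intro r s h
  have h' : Real.exp (-2 * ω * r) = Real.exp (-2 * ω * s) := by
    apply Complex.ofReal_injective
    simpa [qexp] using h
  have h2 : (r : ℝ) = s := mul_left_cancel₀ (by simp [hω.ne']) (Real.exp_injective h')
  exact_mod_cast h2

lemma ne_zero_of_mem_PhiNonInt {ω : ℝ} (hω : 0 < ω) {f : HAlg (qOf ω) → HAlg (qOf ω)}
    (hf : f ∈ PhiNonInt ω) {x : HAlg (qOf ω)} (hx : x ≠ 0) : f x ≠ 0 := by
  obtain ⟨n, hn, rfl | rfl⟩ := hf
  · refine comm_genA_ne_zero (fun k h => hn k ?_) hx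
    rw [qOf_pow] at h
    exact_mod_cast qexp_injective hω h
  · refine comm_genB_ne_zero (fun l h => hn (-l) ?_) hx
    rw [qOf_pow, qexp_mul, show (1 : ℂ) = qexp ω 0 by simp [qexp]] at h
    have := qexp_injective hω h
    push_cast
    linarith

/-- If `ψ` is a finite composition of maps of the form `θ_n` or `η_n`
with `n ∈ ℚ ∖ ℤ`, then for every nonzero `U ∈ H(q)` the element `ψ(U)` is nonzero
(here `q = e^{-2ω}`, `ω > 0`). -/
theorem statement_10 (ω : ℝ) (hω : 0 < ω)
    (L : List (HAlg (qOf ω) → HAlg (qOf ω))) (hL : ∀ f ∈ L, f ∈ PhiNonInt ω)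
    (U : HAlg (qOf ω)) (hU : U ≠ 0) :
    (L.foldr (· ∘ ·) id) U ≠ 0 := by
  induction L with
  | nil => exact hU
  | cons f L ih =>
    exact ne_zero_of_mem_PhiNonInt hω (hL f (by simp)) (ih fun g hg => hL g (by simp [hg]))
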